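/- Assume the equation x' = −x² + q(t)x + p(t) has an attractive hyperbolic solution b̃_{q,p}. Then for every ε > 0 there exists δ_ε > 0 such that: for all bounded continuous functions q̄, p̄ : ℝ → ℝ with ‖q̄ − q‖ < δ_ε and ‖p̄ − p‖ < δ_ε, the perturbed equation x' = −x² + q̄(t)x + p̄(t) has an attractive hyperbolic solution b̃_{q̄,p̄} with ‖b̃_{q,p} − b̃_{q̄,p̄}‖ < ε; moreover, there exists a common dichotomy constant pair (k, β) valid for all the variational equations z' = (−2 b̃_{q̄,p̄}(t) + q̄(t)) z over all such q̄, p̄. The analogous statement holds with 'attractive' replaced by 'repulsive' throughout. -/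

import Mathlib

open Set Filter

/-- The right-hand side of the quadratic equation `x' = -x² + Q(t)x + P(t)`. -/
def quadF (Q P : ℝ → ℝ) : ℝ → ℝ → ℝ := fun t x => -x ^ 2 + Q t * x + P t

/-- `b` is a globally defined bounded solution of `x' = -x² + Q(t)x + P(t)`. -/
def IsBddSol (Q P b : ℝ → ℝ) : Prop :=
  (∀ t, HasDerivAt b (quadF Q P t (b t)) t) ∧ ∃ C, ∀ t, |b t| ≤ C

/-- `(k, β)` is a dichotomy constant pair witnessing that the variational equation
`z' = (-2 b(t) + Q(t)) z` is Hurwitz at `+∞` (attractive case). -/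
def AttrDich (Q b : ℝ → ℝ) (k β : ℝ) : Prop :=
  1 ≤ k ∧ 0 < β ∧ ∀ s t : ℝ, s ≤ t →
    Real.exp (∫ l in s..t, (-2 * b l + Q l)) ≤ k * Real.exp (-β * (t - s))

/-- `(k, β)` is a dichotomy constant pair witnessing that the variational equation
`z' = (-2 b(t) + Q(t)) z` is Hurwitz at `−∞` (repulsive case). -/
def RepDich (Q b : ℝ → ℝ) (k β : ℝ) : Prop :=
  1 ≤ k ∧ 0 < β ∧ ∀ s t : ℝ, t ≤ s →
    Real.exp (∫ l in s..t, (-2 * b l + Q l)) ≤ k * Real.exp (β * (t - s))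

/-- `b` is an attractive hyperbolic solution of `x' = -x² + Q(t)x + P(t)`. -/
def IsAttrHyp (Q P b : ℝ → ℝ) : Prop := IsBddSol Q P b ∧ ∃ k β : ℝ, AttrDich Q b k β

/-- `b` is a repulsive hyperbolic solution of `x' = -x² + Q(t)x + P(t)`. -/
def IsRepHyp (Q P b : ℝ → ℝ) : Prop := IsBddSol Q P b ∧ ∃ k β : ℝ, RepDich Q b k β

/-- `b` is a hyperbolic solution of `x' = -x² + Q(t)x + P(t)`. -/
def IsHyp (Q P b : ℝ → ℝ) : Prop := IsAttrHyp Q P b ∨ IsRepHyp Q P b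

/-- The supremum norm distance between `f` and `g` is `< δ`. -/
def SupLt (f g : ℝ → ℝ) (δ : ℝ) : Prop := ∃ d : ℝ, d < δ ∧ ∀ t, |f t - g t| ≤ d

open MeasureTheory

/-- The solution bounded at `-∞` of the linear equation `y' = a(t)y + h(t)`, given by variation of
constants. -/
noncomputable def boundedLinSol (a h : ℝ → ℝ) (t : ℝ) : ℝ :=
  ∫ s in Iic t, Real.exp (∫ l in s..t, a l) * h s

section LinearEquation

variable {a h : ℝ → ℝ} {k β M : ℝ}

lemma integrableOn_exp_neg_mul_sub (hβ : 0 < β) (t : ℝ) :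
    IntegrableOn (fun s => Real.exp (-β * (t - s))) (Iic t) := by
  have := (integrableOn_exp_mul_Iic hβ t).const_mul (Real.exp (-β * t))
  refine IntegrableOn.congr_fun this (fun s _ => ?_) measurableSet_Iic
  simp only [← Real.exp_add]
  ring_nf

lemma integral_exp_neg_mul_sub (hβ : 0 < β) (t : ℝ) :
    ∫ s in Iic t, Real.exp (-β * (t - s)) = 1 / β := by
  have h1 : ∀ s, Real.exp (-β * (t - s)) = Real.exp (-β * t) * Real.exp (β * s) := fun s => by
    rw [← Real.exp_add]; ring_nf
  simp_rw [h1]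
  rw [integral_const_mul, integral_exp_mul_Iic hβ, mul_div_assoc', ← Real.exp_add]
  simp

lemma norm_linKernel_le
    (hd : ∀ s t, s ≤ t → Real.exp (∫ l in s..t, a l) ≤ k * Real.exp (-β * (t - s)))
    (hM : ∀ t, |h t| ≤ M) {s t : ℝ} (hst : s ≤ t) :
    ‖Real.exp (∫ l in s..t, a l) * h s‖ ≤ k * M * Real.exp (-β * (t - s)) := by
  rw [norm_mul, Real.norm_of_nonneg (Real.exp_nonneg _), Real.norm_eq_abs]
  calc _ ≤ k * Real.exp (-β * (t - s)) * M :=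
        mul_le_mul (hd s t hst) (hM s) (abs_nonneg _) ((Real.exp_nonneg _).trans (hd s t hst))
    _ = _ := by ring

lemma integrableOn_linKernel (ha : Continuous a) (hh : Continuous h) (hβ : 0 < β)
    (hd : ∀ s t, s ≤ t → Real.exp (∫ l in s..t, a l) ≤ k * Real.exp (-β * (t - s)))
    (hM : ∀ t, |h t| ≤ M) (t : ℝ) :
    IntegrableOn (fun s => Real.exp (∫ l in s..t, a l) * h s) (Iic t) := by
  have hc : Continuous fun s => Real.exp (∫ l in s..t, a l) * h s := by
    have : (fun s => ∫ l in s..t, a l) = fun s => -∫ l in t..s, a l :=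
      funext fun s => intervalIntegral.integral_symm _ _
    refine Continuous.mul (Real.continuous_exp.comp ?_) hh
    rw [this]
    exact (intervalIntegral.continuous_primitive (fun _ _ => ha.intervalIntegrable _ _) t).neg
  refine Integrable.mono' ((integrableOn_exp_neg_mul_sub hβ t).const_mul (k * M))
    hc.aestronglyMeasurable ?_
  filter_upwards [ae_restrict_mem measurableSet_Iic] with s hs using norm_linKernel_le hd hM hs

lemma abs_boundedLinSol_le (hβ : 0 < β)
    (hd : ∀ s t, s ≤ t → Real.exp (∫ l in s..t, a l) ≤ k * Real.exp (-β * (t - s)))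
    (hM : ∀ t, |h t| ≤ M) (t : ℝ) : |boundedLinSol a h t| ≤ k / β * M := by
  have h1 := norm_integral_le_of_norm_le
    ((integrableOn_exp_neg_mul_sub hβ t).const_mul (k * M))
    ((ae_restrict_mem measurableSet_Iic).mono fun s hs =>
      norm_linKernel_le (a := a) (h := h) hd hM hs)
  rw [integral_const_mul, integral_exp_neg_mul_sub hβ] at h1
  calc |boundedLinSol a h t| ≤ k * M * (1 / β) := h1
    _ = k / β * M := by ring

lemma boundedLinSol_sub {h' : ℝ → ℝ} {M' : ℝ} (ha : Continuous a) (hh : Continuous h)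
    (hh' : Continuous h') (hβ : 0 < β)
    (hd : ∀ s t, s ≤ t → Real.exp (∫ l in s..t, a l) ≤ k * Real.exp (-β * (t - s)))
    (hM : ∀ t, |h t| ≤ M) (hM' : ∀ t, |h' t| ≤ M') (t : ℝ) :
    boundedLinSol a (fun s => h s - h' s) t = boundedLinSol a h t - boundedLinSol a h' t := by
  simp only [boundedLinSol, mul_sub]
  exact integral_sub (integrableOn_linKernel ha hh hβ hd hM t)
    (integrableOn_linKernel ha hh' hβ hd hM' t)

lemma hasDerivAt_boundedLinSol (ha : Continuous a) (hh : Continuous h) (hβ : 0 < β)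
    (hd : ∀ s t, s ≤ t → Real.exp (∫ l in s..t, a l) ≤ k * Real.exp (-β * (t - s)))
    (hM : ∀ t, |h t| ≤ M) (t : ℝ) :
    HasDerivAt (boundedLinSol a h) (a t * boundedLinSol a h t + h t) t := by
  set A : ℝ → ℝ := fun t => ∫ l in (0 : ℝ)..t, a l
  have hAd : ∀ t, HasDerivAt A (a t) t := fun t => ha.integral_hasStrictDerivAt 0 t |>.hasDerivAt
  have hAc : Continuous A := continuous_iff_continuousAt.2 fun t => (hAd t).continuousAt
  have hker : ∀ s t, Real.exp (∫ l in s..t, a l) * h s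
      = Real.exp (A t) * (Real.exp (-A s) * h s) := fun s t => by
    rw [← mul_assoc, ← Real.exp_add, ← intervalIntegral.integral_interval_sub_left
      (ha.intervalIntegrable 0 t) (ha.intervalIntegrable 0 s)]
    rfl
  set w : ℝ → ℝ := fun s => Real.exp (-A s) * h s with hw
  have hwc : Continuous w := by fun_prop
  have hwi : ∀ t, IntegrableOn w (Iic t) := fun t => by
    have := (integrableOn_linKernel ha hh hβ hd hM t).const_mul (Real.exp (-A t))
    refine IntegrableOn.congr_fun this (fun s _ => ?_) measurableSet_Iic
    simp only [hker, ← mul_assoc, ← Real.exp_add]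
    simp [hw]
  have hsol : boundedLinSol a h = fun t =>
      Real.exp (A t) * ((∫ s in Iic (0 : ℝ), w s) + ∫ s in (0 : ℝ)..t, w s) := by
    funext t
    rw [← intervalIntegral.integral_Iic_sub_Iic (hwi 0) (hwi t), add_sub_cancel,
      ← integral_const_mul]
    simp only [boundedLinSol, hker]
    rfl
  have hder := (hAd t).exp.mul
    (((hwc.integral_hasStrictDerivAt 0 t).hasDerivAt).const_add (∫ s in Iic (0 : ℝ), w s))
  rw [hsol]
  refine hder.congr_deriv ?_
  have : Real.exp (A t) * w t = h t := by simp [hw, ← mul_assoc, ← Real.exp_add]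
  simp only [this]
  ring

end LinearEquation

lemma exists_bounded_solution_of_perturbation {a d g : ℝ → ℝ} {k β δ G r : ℝ}
    (ha : Continuous a) (hdc : Continuous d) (hgc : Continuous g) (hβ : 0 < β) (hk : 1 ≤ k)
    (hdich : ∀ s t, s ≤ t → Real.exp (∫ l in s..t, a l) ≤ k * Real.exp (-β * (t - s)))
    (hd : ∀ t, |d t| ≤ δ) (hg : ∀ t, |g t| ≤ G) (hr : 0 ≤ r)
    (hmaps : k / β * (r ^ 2 + δ * r + G) ≤ r) (hcontr : k / β * (2 * r + δ) ≤ 1 / 2) :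
    ∃ y : ℝ → ℝ, (∀ t, HasDerivAt y (a t * y t + (-y t ^ 2 + d t * y t + g t)) t) ∧
      ∀ t, |y t| ≤ r := by
  let H : BoundedContinuousFunction ℝ ℝ → ℝ → ℝ := fun y t => -y t ^ 2 + d t * y t + g t
  have hHc : ∀ y, Continuous (H y) := fun y => by
    have := y.continuous
    fun_prop
  have hHb : ∀ (y : BoundedContinuousFunction ℝ ℝ) (R : ℝ), (∀ t, |y t| ≤ R) →
      ∀ t, |H y t| ≤ R ^ 2 + δ * R + G := fun y R hR t => by
    have h1 : |y t ^ 2| ≤ R ^ 2 := by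
      rw [abs_pow]; exact pow_le_pow_left₀ (abs_nonneg _) (hR t) 2
    have h2 : |d t * y t| ≤ δ * R := by
      rw [abs_mul]
      exact mul_le_mul (hd t) (hR t) (abs_nonneg _) ((abs_nonneg _).trans (hd t))
    have := hg t
    simp only [H]
    rw [abs_le] at *
    constructor <;> linarith [h1.1, h1.2, h2.1, h2.2]
  have hHn : ∀ y t, |H y t| ≤ ‖y‖ ^ 2 + δ * ‖y‖ + G := fun y => hHb y _ fun t => y.norm_coe_le_norm t
  have hder : ∀ y t, HasDerivAt (boundedLinSol a (H y))
      (a t * boundedLinSol a (H y) t + H y t) t := fun y =>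
    hasDerivAt_boundedLinSol ha (hHc y) hβ hdich (hHn y)
  let T : BoundedContinuousFunction ℝ ℝ → BoundedContinuousFunction ℝ ℝ := fun y =>
    BoundedContinuousFunction.ofNormedAddCommGroup (boundedLinSol a (H y))
      (continuous_iff_continuousAt.2 fun t => (hder y t).continuousAt) _
      (abs_boundedLinSol_le hβ hdich (hHn y))
  have hkβ : 0 ≤ k / β := by positivity
  have hball : ∀ y ∈ Metric.closedBall (0 : BoundedContinuousFunction ℝ ℝ) r, ∀ t, |y t| ≤ r :=
    fun y hy t => (y.norm_coe_le_norm t).trans (mem_closedBall_zero_iff.1 hy)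
  have hT : MapsTo T (Metric.closedBall 0 r) (Metric.closedBall 0 r) := fun y hy => by
    rw [mem_closedBall_zero_iff, BoundedContinuousFunction.norm_le hr]
    exact fun t => (abs_boundedLinSol_le hβ hdich (hHb y r (hball y hy)) t).trans hmaps
  have hlip : ContractingWith (1 / 2) (hT.restrict T _ _) := by
    refine ⟨by rw [← NNReal.coe_lt_coe]; norm_num, LipschitzWith.of_dist_le_mul ?_⟩
    rintro ⟨y, hy⟩ ⟨z, hz⟩
    change dist (T y) (T z) ≤ ((1 / 2 : NNReal) : ℝ) * dist y z
    push_cast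
    rw [BoundedContinuousFunction.dist_le (by positivity)]
    intro t
    have hdiff : ∀ s, |H y s - H z s| ≤ (2 * r + δ) * dist y z := fun s => by
      have e : H y s - H z s = (-(y s + z s) + d s) * (y s - z s) := by simp only [H]; ring
      rw [e, abs_mul]
      refine mul_le_mul ?_ (y.dist_coe_le_dist s) (abs_nonneg _) (by
        linarith [abs_nonneg (d 0), hd 0])
      have h1 := hball y hy s
      have h2 := hball z hz s
      have h3 := hd s
      rw [abs_le] at *
      constructor <;> linarith [h1.1, h1.2, h2.1, h2.2]
    rw [Real.dist_eq]
    change |boundedLinSol a (H y) t - boundedLinSol a (H z) t| ≤ _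
    rw [← boundedLinSol_sub ha (hHc y) (hHc z) hβ hdich (hHn y) (hHn z)]
    calc _ ≤ k / β * ((2 * r + δ) * dist y z) := abs_boundedLinSol_le hβ hdich hdiff t
      _ = k / β * (2 * r + δ) * dist y z := by ring
      _ ≤ _ := by gcongr
  obtain ⟨y, hy, hfix, -⟩ := hlip.exists_fixedPoint' Metric.isClosed_closedBall.isComplete hT
    (Metric.mem_closedBall_self hr) (edist_ne_top _ _)
  have hy' : boundedLinSol a (H y) = y := congrArg DFunLike.coe hfix
  refine ⟨y, fun t => ?_, hball y hy⟩
  have := hder y t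
  rwa [hy'] at this

lemma exists_attractive_of_perturbation {q p b : ℝ → ℝ} (hq : Continuous q) (hp : Continuous p)
    (hb : IsAttrHyp q p b) {ε : ℝ} (hε : 0 < ε) :
    ∃ δ > (0 : ℝ), ∃ k β : ℝ, 1 ≤ k ∧ 0 < β ∧
      ∀ q' p' : ℝ → ℝ, Continuous q' → Continuous p' → SupLt q' q δ → SupLt p' p δ →
        ∃ b' : ℝ → ℝ, IsBddSol q' p' b' ∧ AttrDich q' b' k β ∧ SupLt b b' ε := by
  obtain ⟨⟨hsol, B, hB⟩, k, β, hk, hβ, hdich⟩ := hb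
  have hbc : Continuous b := continuous_iff_continuousAt.2 fun t => (hsol t).continuousAt
  have hB0 : 0 ≤ B := (abs_nonneg _).trans (hB 0)
  have hk0 : 0 < k := by linarith
  obtain ⟨r, hr, hrε, hrβ⟩ : ∃ r > 0, r < ε ∧ k / β * r ≤ 1 / 8 := by
    refine ⟨min (ε / 2) (β / (8 * k)), by positivity,
      (min_le_left _ _).trans_lt (by linarith), ?_⟩
    calc _ ≤ k / β * (β / (8 * k)) := by gcongr; exact min_le_right _ _
      _ = 1 / 8 := by field_simp
  obtain ⟨δ, hδ, hδβ, hδr⟩ : ∃ δ > 0, k / β * δ ≤ 1 / 8 ∧ k / β * (δ * (B + 1)) ≤ r / 2 := by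
    refine ⟨min (β / (8 * k)) (r * β / (2 * k * (B + 1))), by positivity, ?_, ?_⟩
    · calc _ ≤ k / β * (β / (8 * k)) := by gcongr; exact min_le_left _ _
        _ = 1 / 8 := by field_simp
    · calc _ ≤ k / β * (r * β / (2 * k * (B + 1)) * (B + 1)) := by gcongr; exact min_le_right _ _
        _ = r / 2 := by field_simp
  refine ⟨δ, hδ, k, β / 2, hk, by positivity, fun q' p' hq' hp' ⟨d₁, hd₁, hqq⟩ ⟨d₂, hd₂, hpp⟩ => ?_⟩
  have hqδ : ∀ t, |q' t - q t| ≤ δ := fun t => (hqq t).trans hd₁.le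
  have hpδ : ∀ t, |p' t - p t| ≤ δ := fun t => (hpp t).trans hd₂.le
  have hg : ∀ t, |(q' t - q t) * b t + (p' t - p t)| ≤ δ * (B + 1) := fun t => by
    calc _ ≤ |q' t - q t| * |b t| + |p' t - p t| := by
          rw [← abs_mul]; exact abs_add_le _ _
      _ ≤ δ * B + δ := by
          gcongr
          exacts [hqδ t, hB t, hpδ t]
      _ = _ := by ring
  obtain ⟨y, hy, hyr⟩ := exists_bounded_solution_of_perturbation
    (a := fun t => -2 * b t + q t) (d := fun t => q' t - q t)
    (g := fun t => (q' t - q t) * b t + (p' t - p t)) (by fun_prop) (by fun_prop) (by fun_prop)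
    hβ hk hdich hqδ hg hr.le (by nlinarith) (by nlinarith)
  have hyc : Continuous y := continuous_iff_continuousAt.2 fun t => (hy t).continuousAt
  refine ⟨fun t => b t + y t, ⟨fun t => ?_, B + r, fun t => ?_⟩, ⟨hk, by positivity, ?_⟩,
    r, hrε, fun t => ?_⟩
  · refine ((hsol t).add (hy t)).congr_deriv ?_
    simp only [quadF]
    ring
  · exact (abs_add_le _ _).trans (add_le_add (hB t) (hyr t))
  · intro s t hst
    have hsmall : 2 * r + δ ≤ β / 2 := by
      have h1 : k / β * (2 * r + δ) ≤ 3 / 8 := by nlinarith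
      rw [div_mul_eq_mul_div, div_le_iff₀ hβ] at h1
      nlinarith
    have h_le : ∫ l in s..t, (-2 * (b l + y l) + q' l)
        ≤ (∫ l in s..t, (-2 * b l + q l)) + β / 2 * (t - s) := by
      have hc : ∫ _ in s..t, β / 2 = β / 2 * (t - s) := by
        rw [intervalIntegral.integral_const, smul_eq_mul, mul_comm]
      rw [← hc, ← intervalIntegral.integral_add
        (Continuous.intervalIntegrable (by fun_prop) _ _) intervalIntegrable_const]
      refine intervalIntegral.integral_mono_on hst
        (Continuous.intervalIntegrable (by fun_prop) _ _)
        (Continuous.intervalIntegrable (by fun_prop) _ _) fun l _ => ?_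
      have h1 := (abs_le.1 (hyr l)).1
      have h2 := (abs_le.1 (hqδ l)).2
      linarith
    calc _ ≤ Real.exp (∫ l in s..t, (-2 * b l + q l)) * Real.exp (β / 2 * (t - s)) := by
          rw [← Real.exp_add]; exact Real.exp_le_exp.2 h_le
      _ ≤ k * Real.exp (-β * (t - s)) * Real.exp (β / 2 * (t - s)) := by
          gcongr; exact hdich s t hst
      _ = _ := by
          rw [mul_assoc, ← Real.exp_add]; ring_nf
  · simpa using hyr t

section TimeReversal

variable {Q P b : ℝ → ℝ} {k β : ℝ}

lemma IsBddSol.comp_neg (h : IsBddSol Q P b) :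
    IsBddSol (fun t => -Q (-t)) (fun t => P (-t)) fun t => -b (-t) := by
  obtain ⟨hsol, C, hC⟩ := h
  refine ⟨fun t => ?_, C, fun t => by simpa using hC (-t)⟩
  refine (((hsol (-t)).comp t (hasDerivAt_neg t)).neg).congr_deriv ?_
  simp only [quadF]
  ring

lemma integral_variational_comp_neg (s t : ℝ) :
    ∫ l in s..t, (-2 * -b (-l) + -Q (-l)) = ∫ l in -s..-t, (-2 * b l + Q l) := by
  rw [intervalIntegral.integral_symm (-t) (-s), ← intervalIntegral.integral_neg,
    ← intervalIntegral.integral_comp_neg]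
  congr 1
  funext l
  ring

lemma RepDich.comp_neg (h : RepDich Q b k β) :
    AttrDich (fun t => -Q (-t)) (fun t => -b (-t)) k β := by
  refine ⟨h.1, h.2.1, fun s t hst => ?_⟩
  rw [integral_variational_comp_neg]
  refine (h.2.2 (-s) (-t) (neg_le_neg hst)).trans_eq ?_
  ring_nf

lemma AttrDich.comp_neg (h : AttrDich Q b k β) :
    RepDich (fun t => -Q (-t)) (fun t => -b (-t)) k β := by
  refine ⟨h.1, h.2.1, fun s t hst => ?_⟩
  rw [integral_variational_comp_neg]
  refine (h.2.2 (-s) (-t) (neg_le_neg hst)).trans_eq ?_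
  ring_nf

end TimeReversal

theorem stmt5 (q p : ℝ → ℝ)
    (hqb : ∃ C, ∀ t, |q t| ≤ C) (hqu : UniformContinuous q)
    (hpb : ∃ C, ∀ t, |p t| ≤ C) (hpu : UniformContinuous p) :
    -- attractive case
    (∀ b : ℝ → ℝ, IsAttrHyp q p b → ∀ ε > (0:ℝ), ∃ δ > (0:ℝ),
      ∃ k β : ℝ, 1 ≤ k ∧ 0 < β ∧
        ∀ q' p' : ℝ → ℝ, Continuous q' → Continuous p' →
          SupLt q' q δ → SupLt p' p δ →
          ∃ b' : ℝ → ℝ, IsBddSol q' p' b' ∧ AttrDich q' b' k β ∧ SupLt b b' ε) ∧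
    -- repulsive case
    (∀ b : ℝ → ℝ, IsRepHyp q p b → ∀ ε > (0:ℝ), ∃ δ > (0:ℝ),
      ∃ k β : ℝ, 1 ≤ k ∧ 0 < β ∧
        ∀ q' p' : ℝ → ℝ, Continuous q' → Continuous p' →
          SupLt q' q δ → SupLt p' p δ →
          ∃ b' : ℝ → ℝ, IsBddSol q' p' b' ∧ RepDich q' b' k β ∧ SupLt b b' ε) := by
  have hq := hqu.continuous
  have hp := hpu.continuous
  refine ⟨fun b hb ε hε => exists_attractive_of_perturbation hq hp hb hε, ?_⟩
  rintro b ⟨hsol, k, β, hdich⟩ ε hε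
  obtain ⟨δ, hδ, k', β', hk', hβ', H⟩ := exists_attractive_of_perturbation
    (q := fun t => -q (-t)) (p := fun t => p (-t)) (by fun_prop) (by fun_prop)
    ⟨hsol.comp_neg, k, β, hdich.comp_neg⟩ hε
  refine ⟨δ, hδ, k', β', hk', hβ', fun q' p' hq' hp' ⟨d₁, hd₁, hqq⟩ ⟨d₂, hd₂, hpp⟩ => ?_⟩
  obtain ⟨b', hb', hdich', d, hd, hbb⟩ := H (fun t => -q' (-t)) (fun t => p' (-t)) (by fun_prop)
    (by fun_prop)
    ⟨d₁, hd₁, fun t => by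
      rw [neg_sub_neg, abs_sub_comm]
      exact hqq (-t)⟩
    ⟨d₂, hd₂, fun t => hpp (-t)⟩
  refine ⟨fun t => -b' (-t), by simpa using hb'.comp_neg, by simpa using hdich'.comp_neg,
    d, hd, fun t => ?_⟩
  have := hbb (-t)
  rw [← abs_neg]
  convert this using 2
  simp
  ring
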